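/- arXiv:2311.05246 — 3 statements merged into one kernel-verified Lean document; each statement's English description precedes it below -/
import Mathlib

section
/- Fix α ∈ C̄ and ζ ∈ α+ℤ such that ℓ₀ℓ_r has no roots in {η ∈ α+ℤ : η < ζ}. Let b ∈ Sol_α(L) satisfy min_{i=1,…,r} ν_q(b(ζ+i−1)) = 0. Then min_{i=1,…,r} ν_q(b(ζ−n+i−1)) = 0 for every integer n ≥ 0; consequently liminf_{n→∞} ν_q(b(ζ−n)) = 0. -/
set_option maxHeartbeats 1000000
set_option synthInstance.maxHeartbeats 200000

open Polynomial Filter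

noncomputable section

namespace PRec

variable (C : Type*) [Field C] [CharZero C]

/-- The algebraic closure of the coefficient field. -/
abbrev Cbar := AlgebraicClosure C

/-- The field of formal Laurent series over the algebraic closure. -/
abbrev LS := LaurentSeries (Cbar C)

/-- The Laurent-series variable `q`. -/
def qv : LS C := HahnSeries.single 1 1

open Classical in
/-- The valuation `ν_q`, with `ν_q 0 = ⊤`, valued in the extended reals. -/
def nuq (a : LS C) : EReal := if a = 0 then ⊤ else (((a.order : ℤ) : ℝ) : EReal)

/-- Evaluation of a rational function at the point `α + m + q`. -/
def evalAt (α : Cbar C) (m : ℤ) (p : RatFunc C) : LS C :=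
  RatFunc.eval ((algebraMap (Cbar C) (LS C)).comp (algebraMap C (Cbar C)))
    (algebraMap (Cbar C) (LS C) α + (m : LS C) + qv C) p

/-- Shorthand for the canonical map `C[x] → C(x)`. -/
abbrev toRat : Polynomial C →+* RatFunc C := algebraMap (Polynomial C) (RatFunc C)

variable (ℓ : ℕ → Polynomial C) (r : ℕ)

/-- The solution space `Sol_α(L)` of `L = ℓ₀ + ℓ₁ S + ⋯ + ℓ_r S^r` at `α`,
indexed so that `b n` stands for the value of the solution at `α + n`. -/
def SolSet (α : Cbar C) : Set (ℤ → LS C) :=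
  {b | ∀ n : ℤ, ∑ i ∈ Finset.range (r + 1),
      evalAt C α n (toRat C (ℓ i)) * b (n + i) = 0}

/-- The action of an element `f = f₀ + f₁ S + ⋯ + f_{r-1} S^{r-1}` of
`A = C(x)[S]/⟨L⟩` (represented by its coefficient vector) on a sequence. -/
def elemApply (α : Cbar C) (f : Fin r → RatFunc C) (b : ℤ → LS C) : ℤ → LS C :=
  fun n => ∑ i : Fin r, evalAt C α n (f i) * b (n + (i : ℤ))

/-- Truncated subtraction on extended reals with the convention `⊤ - ⊤ = ⊤`. -/
def esub (a b : EReal) : EReal := if b = ⊤ then ⊤ else a - b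

/-- The value function `val_α` on `A`. -/
def valAt (α : Cbar C) (f : Fin r → RatFunc C) : EReal :=
  ⨅ b ∈ SolSet C ℓ r α,
    esub (nuq C (elemApply C r α f b 0))
      (Filter.liminf (fun n : ℕ => nuq C (b (-(n : ℤ)))) Filter.atTop)

/-- `f ∈ A` is (locally) integral at `α`. -/
def IntegralAt (α : Cbar C) (f : Fin r → RatFunc C) : Prop :=
  0 ≤ valAt C ℓ r α f

/-- Membership in the local subring `C(x)_α` of rational functions having no pole at `α`. -/
def InLocalRing (α : Cbar C) (f : RatFunc C) : Prop :=
  ∃ p q : Polynomial C, (Polynomial.aeval α) q ≠ 0 ∧ f = toRat C p / toRat C q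

/-- `W` is a `C(x)`-vector space basis of `A` (represented on coefficient vectors). -/
def IsVSBasis (W : Fin r → (Fin r → RatFunc C)) : Prop :=
  LinearIndependent (RatFunc C) W ∧
    Submodule.span (RatFunc C) (Set.range W) = (⊤ : Submodule (RatFunc C) (Fin r → RatFunc C))

/-- The `C(x)_α`-span of a tuple of elements of `A`. -/
def localSpan (α : Cbar C) (W : Fin r → (Fin r → RatFunc C)) :
    Set (Fin r → RatFunc C) :=
  {f | ∃ c : Fin r → RatFunc C, (∀ i, InLocalRing C α (c i)) ∧ f = ∑ i, c i • W i}

/-- `W` is a local integral basis of `A` at `α`. -/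
def IsLocalIntegralBasis (α : Cbar C) (W : Fin r → (Fin r → RatFunc C)) : Prop :=
  IsVSBasis C r W ∧ (∀ i, IntegralAt C ℓ r α (W i)) ∧
    ∀ f : Fin r → RatFunc C, IntegralAt C ℓ r α f → f ∈ localSpan C r α W

/-- The standard basis `1, S, …, S^{r-1}` of `A`. -/
def stdBasis : Fin r → (Fin r → RatFunc C) :=
  fun i j => if j = i then 1 else 0

/-- The shift automorphism `p(x) ↦ p(x+c)` of the polynomial ring. -/
def polyShiftEquiv (c : C) : Polynomial C ≃+* Polynomial C where
  toFun p := p.comp (X + Polynomial.C c)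
  invFun p := p.comp (X - Polynomial.C c)
  left_inv p := by
    show (p.comp (X + Polynomial.C c)).comp (X - Polynomial.C c) = p
    rw [Polynomial.comp_assoc]; simp
  right_inv p := by
    show (p.comp (X - Polynomial.C c)).comp (X + Polynomial.C c) = p
    rw [Polynomial.comp_assoc]; simp
  map_add' p q := by simp [Polynomial.add_comp]
  map_mul' p q := by simp [Polynomial.mul_comp]

/-- The shift `σ^k`, `p(x) ↦ p(x+k)`, on polynomials, for `k : ℤ`. -/
def polyShift (k : ℤ) (p : Polynomial C) : Polynomial C := polyShiftEquiv C (k : C) p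

/-- `σ` on polynomials. -/
def polyσ : Polynomial C ≃+* Polynomial C := polyShiftEquiv C 1

/-- The shift automorphism `σ : f(x) ↦ f(x+1)` of the rational function field. -/
def ratσ : RatFunc C →+* RatFunc C :=
  RatFunc.mapRingHom (polyσ C : Polynomial C →+* Polynomial C)
    (by
      intro p hp
      simp only [Submonoid.mem_comap]
      refine mem_nonZeroDivisors_iff_ne_zero.mpr ?_
      have hp0 : p ≠ 0 := mem_nonZeroDivisors_iff_ne_zero.mp hp
      simpa using (map_ne_zero_iff _ (polyσ C).injective).mpr hp0)

variable [NeZero r]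

/-- The index `r - 1` as an element of `Fin r`. -/
def lastIdx : Fin r := ⟨r - 1, Nat.sub_lt (Nat.pos_of_ne_zero (NeZero.ne r)) one_pos⟩

/-- The action of `S` on `A = C(x)[S]/⟨L⟩`, on coefficient vectors with respect to the
basis `1, S, …, S^{r-1}`, using `S^r = -(ℓ₀/ℓ_r) - ⋯ - (ℓ_{r-1}/ℓ_r) S^{r-1}`. -/
def Smap (f : Fin r → RatFunc C) : Fin r → RatFunc C :=
  fun j =>
    (if (j : ℕ) = 0 then 0 else
      ratσ C (f ⟨(j : ℕ) - 1, lt_of_le_of_lt (Nat.sub_le _ _) j.isLt⟩))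
      - ratσ C (f (lastIdx r)) * (toRat C (ℓ j) / toRat C (ℓ r))

/-- The difference operator `Δ = S - 1` on `A`. -/
def Dmap (f : Fin r → RatFunc C) : Fin r → RatFunc C :=
  Smap C ℓ r f - f

/-- `f ∈ A` is summable. -/
def IsSummable (f : Fin r → RatFunc C) : Prop :=
  ∃ g : Fin r → RatFunc C, f = Dmap C ℓ r g

/-- `disp_α(p) ≥ k`: `p` has two roots in `α + ℤ` at distance `k`. -/
def DispGe (α : Cbar C) (p : Polynomial (Cbar C)) (k : ℕ) : Prop :=
  ∃ m : ℤ, Polynomial.eval (α + (m : Cbar C)) p = 0 ∧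
    Polynomial.eval (α + (m : Cbar C) + (k : Cbar C)) p = 0

/-- The dispersion `disp_α(p)` as an extended natural number
(`0` by convention for the empty set, which is excluded by the hypotheses below). -/
def dispVal (α : Cbar C) (p : Polynomial (Cbar C)) : ℕ∞ :=
  sSup ((fun k : ℕ => (k : ℕ∞)) '' {k : ℕ | DispGe C α p k})

/-- A polynomial is shift-free if it is coprime to each of its nontrivial shifts. -/
def ShiftFree {K : Type*} [Field K] [CharZero K] (p : Polynomial K) : Prop :=
  ∀ k : ℤ, k ≠ 0 → IsCoprime p (p.comp (X + Polynomial.C (k : K)))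


lemma zero_le_addVal_ofPowerSeries {K : Type*} [Field K] (f : PowerSeries K) :
    0 ≤ HahnSeries.addVal ℤ K (HahnSeries.ofPowerSeries ℤ K f) := by
  rw [HahnSeries.addVal_apply]
  refine HahnSeries.le_orderTop_iff_forall.mpr fun j hj => ?_
  rw [PowerSeries.coeff_coe, if_pos (by exact_mod_cast hj)]

lemma addVal_ofPowerSeries_eq_zero {K : Type*} [Field K] (f : PowerSeries K)
    (hf : PowerSeries.constantCoeff f ≠ 0) :
    HahnSeries.addVal ℤ K (HahnSeries.ofPowerSeries ℤ K f) = 0 := by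
  obtain ⟨g, hg⟩ := (PowerSeries.isUnit_iff_constantCoeff.mpr hf.isUnit).exists_right_inv
  have h := congrArg (fun a => HahnSeries.addVal ℤ K (HahnSeries.ofPowerSeries ℤ K a)) hg
  simp only [map_mul, map_one, AddValuation.map_mul, AddValuation.map_one] at h
  exact (add_eq_zero_iff_of_nonneg (zero_le_addVal_ofPowerSeries f)
    (zero_le_addVal_ofPowerSeries g)).mp h |>.1

/-- The value of a polynomial at `β + q`, as a power series in `q`. -/
def evalPS (β : Cbar C) (p : Polynomial C) : PowerSeries (Cbar C) :=
  p.eval₂ ((PowerSeries.C).comp (algebraMap C (Cbar C))) (PowerSeries.C β + PowerSeries.X)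

lemma constantCoeff_evalPS (β : Cbar C) (p : Polynomial C) :
    PowerSeries.constantCoeff (evalPS C β p) = aeval β p := by
  rw [evalPS, Polynomial.hom_eval₂, Polynomial.aeval_def]
  congr 1
  simp

lemma evalAt_toRat (α : Cbar C) (m : ℤ) (p : Polynomial C) :
    evalAt C α m (toRat C p) = HahnSeries.ofPowerSeries ℤ _ (evalPS C (α + m) p) := by
  rw [evalAt, RatFunc.eval_algebraMap, evalPS, Polynomial.hom_eval₂]
  have hC (x : Cbar C) : algebraMap (Cbar C) (LS C) x =
      HahnSeries.ofPowerSeries ℤ _ (PowerSeries.C x) := HahnSeries.algebraMap_apply' ℤ x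
  congr 1
  simp only [hC, map_add, map_intCast, HahnSeries.ofPowerSeries_X, qv]

lemma zero_le_nuq (a : LS C) : 0 ≤ nuq C a ↔ 0 ≤ HahnSeries.addVal ℤ (Cbar C) a := by
  rw [nuq, HahnSeries.addVal_apply]
  split_ifs with h
  · simp [h]
  · rw [← HahnSeries.order_eq_orderTop_of_ne_zero h]
    norm_cast

lemma nuq_eq_zero (a : LS C) : nuq C a = 0 ↔ HahnSeries.addVal ℤ (Cbar C) a = 0 := by
  rw [nuq, HahnSeries.addVal_apply]
  split_ifs with h
  · simp [h]
  · rw [← HahnSeries.order_eq_orderTop_of_ne_zero h]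
    norm_cast

lemma iInf_nuq_eq_zero (hr : 1 ≤ r) (f : Fin r → LS C) :
    (⨅ i, nuq C (f i)) = 0 ↔
      (∀ i, 0 ≤ HahnSeries.addVal ℤ (Cbar C) (f i)) ∧
        ∃ i, HahnSeries.addVal ℤ (Cbar C) (f i) = 0 := by
  have : Nonempty (Fin r) := ⟨⟨0, hr⟩⟩
  simp only [← zero_le_nuq, ← nuq_eq_zero]
  constructor
  · intro h
    refine ⟨fun i => h ▸ iInf_le _ i, ?_⟩
    obtain ⟨i, hi⟩ := exists_eq_ciInf_of_finite (f := fun i => nuq C (f i))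
    exact ⟨i, hi.trans h⟩
  · rintro ⟨h, i, hi⟩
    exact le_antisymm (hi ▸ iInf_le _ i) (le_iInf h)

/-- Integrality of a term of a vanishing linear combination whose coefficient is a unit. -/
lemma le_addVal_of_sum_eq_zero {ι : Type*} [DecidableEq ι]
    {R : Type*} [Ring R] (v : AddValuation R (WithTop ℤ))
    (s : Finset ι) (c x : ι → R) (g : WithTop ℤ)
    (h : ∑ i ∈ s, c i * x i = 0) (hc : ∀ i ∈ s, 0 ≤ v (c i)) {j : ι} (hj : j ∈ s)
    (hcj : v (c j) = 0) (hx : ∀ i ∈ s, i ≠ j → g ≤ v (x i)) : g ≤ v (x j) := by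
  rw [← Finset.add_sum_erase s _ hj, add_eq_zero_iff_eq_neg] at h
  have h' := congrArg v h
  rw [v.map_mul, hcj, zero_add, v.map_neg] at h'
  rw [h']
  refine v.map_le_sum fun i hi => ?_
  rw [Finset.mem_erase] at hi
  rw [v.map_mul]
  simpa using add_le_add (hc i hi.2) (hx i hi.2 hi.1)

lemma iInf_nuq_pred (hr : 1 ≤ r) (α : Cbar C) (m : ℤ)
    (hm : aeval (α + (m : Cbar C)) (ℓ 0 * ℓ r) ≠ 0)
    (b : ℤ → LS C) (hb : b ∈ SolSet C ℓ r α)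
    (h : (⨅ i : Fin r, nuq C (b (m + 1 + (i : ℤ)))) = 0) :
    (⨅ i : Fin r, nuq C (b (m + (i : ℤ)))) = 0 := by
  rw [iInf_nuq_eq_zero C r hr] at h ⊢
  obtain ⟨hnonneg, k, hk⟩ := h
  rw [map_mul, mul_ne_zero_iff] at hm
  have hsol := hb m
  have hcoeff : ∀ i ∈ Finset.range (r + 1),
      0 ≤ HahnSeries.addVal ℤ (Cbar C) (evalAt C α m (toRat C (ℓ i))) := fun i _ => by
    rw [evalAt_toRat]
    exact zero_le_addVal_ofPowerSeries _
  have hunit : ∀ i, aeval (α + (m : Cbar C)) (ℓ i) ≠ 0 →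
      HahnSeries.addVal ℤ (Cbar C) (evalAt C α m (toRat C (ℓ i))) = 0 := fun i hi => by
    rw [evalAt_toRat]
    exact addVal_ofPowerSeries_eq_zero _ (by rwa [constantCoeff_evalPS])
  have htail : ∀ i : ℕ, i ≠ 0 → i ≤ r → 0 ≤ HahnSeries.addVal ℤ (Cbar C) (b (m + i)) := by
    intro i hi hir
    have := hnonneg ⟨i - 1, by lia⟩
    rwa [show m + 1 + ((i - 1 : ℕ) : ℤ) = m + i by lia] at this
  have hall : ∀ i : ℕ, i ≤ r → 0 ≤ HahnSeries.addVal ℤ (Cbar C) (b (m + i)) := by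
    intro i hir
    rcases eq_or_ne i 0 with rfl | hi
    · exact le_addVal_of_sum_eq_zero _ _ _ (fun i : ℕ => b (m + i)) 0 hsol hcoeff
        (j := 0) (by simp) (hunit 0 hm.1)
        fun i hi hi0 => htail i hi0 (by simpa [Nat.lt_succ_iff] using hi)
    · exact htail i hi hir
  refine ⟨fun i => hall i i.2.le, ?_⟩
  by_contra! hne
  have hone : ∀ i : ℕ, i < r → 1 ≤ HahnSeries.addVal ℤ (Cbar C) (b (m + i)) := by
    intro i hi
    have hpos := lt_of_le_of_ne (hall i hi.le) (hne ⟨i, hi⟩).symm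
    generalize HahnSeries.addVal ℤ (Cbar C) (b (m + i)) = v at hpos
    induction v with
    | top => exact le_top
    | coe v => exact_mod_cast Int.add_one_le_of_lt (by exact_mod_cast hpos : (0 : ℤ) < v)
  have hlast : 1 ≤ HahnSeries.addVal ℤ (Cbar C) (b (m + r)) :=
    le_addVal_of_sum_eq_zero _ _ _ (fun i : ℕ => b (m + i)) 1 hsol hcoeff
      (j := r) (by simp) (hunit r hm.2)
      fun i hi hir => hone i (by have := Finset.mem_range.mp hi; lia)
  have hk1 : 1 ≤ HahnSeries.addVal ℤ (Cbar C) (b (m + 1 + (k : ℤ))) := by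
    rw [show m + 1 + (k : ℤ) = m + ((k + 1 : ℕ) : ℤ) by push_cast; ring]
    rcases (Nat.succ_le_of_lt k.2).lt_or_eq with h | h
    · exact hone _ h
    · rwa [← h] at hlast
  rw [hk] at hk1
  exact absurd hk1 (by decide)

theorem statement1 (hr : 1 ≤ r) (hℓ : ℓ 0 * ℓ r ≠ 0) (α : Cbar C) (z₀ : ℤ)
    (hroots : ∀ m : ℤ, m < z₀ → (Polynomial.aeval (α + (m : Cbar C))) (ℓ 0 * ℓ r) ≠ 0)
    (b : ℤ → LS C) (hb : b ∈ SolSet C ℓ r α)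
    (h0 : (⨅ i : Fin r, nuq C (b (z₀ + (i : ℤ)))) = 0) :
    (∀ n : ℕ, (⨅ i : Fin r, nuq C (b (z₀ - (n : ℤ) + (i : ℤ)))) = 0) ∧
      Filter.liminf (fun n : ℕ => nuq C (b (z₀ - (n : ℤ)))) Filter.atTop = 0 := by
  have hwin : ∀ n : ℕ, (⨅ i : Fin r, nuq C (b (z₀ - (n : ℤ) + (i : ℤ)))) = 0 := by
    intro n
    induction n with
    | zero => simpa using h0
    | succ n ih =>
      refine iInf_nuq_pred C ℓ r hr α _ (hroots _ (by lia)) b hb ?_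
      rwa [show z₀ - ((n + 1 : ℕ) : ℤ) + 1 = z₀ - n by push_cast; ring]
  refine ⟨hwin, le_antisymm ?_ ?_⟩
  · refine liminf_le_of_frequently_le' (frequently_atTop.mpr fun n => ?_)
    obtain ⟨-, ⟨i, hir⟩, hi⟩ := (iInf_nuq_eq_zero C r hr _).mp (hwin (n + r))
    refine ⟨n + r - i, by omega, ((nuq_eq_zero C _).mpr ?_).le⟩
    rwa [show z₀ - ((n + r - i : ℕ) : ℤ) = z₀ - ((n + r : ℕ) : ℤ) + (i : ℤ) by omega]
  · refine le_liminf_of_le (by isBoundedDefault) (Eventually.of_forall fun n => ?_)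
    have := iInf_le (fun i : Fin r => nuq C (b (z₀ - (n : ℤ) + (i : ℤ)))) ⟨0, hr⟩
    rw [hwin n] at this
    simpa using this

end PRec
end
end

section
/- Fix α ∈ C̄ and ζ ∈ α+ℤ such that ℓ₀ℓ_r has no roots in {η ∈ α+ℤ : η < ζ}, and let b₁, …, b_r be the basis of Sol_α(L) determined by the initial values b_j(ζ+i−1) = δ_{i,j} for i, j = 1, …, r. Then for every f ∈ A and every η ∈ α+ℤ, val_η(f) = min_{j=1,…,r} ν_q((f·b_j)(η)). -/
set_option maxHeartbeats 1000000
set_option synthInstance.maxHeartbeats 200000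

open Polynomial Filter

noncomputable section

namespace PRec

variable (C : Type*) [Field C] [CharZero C]

variable (ℓ : ℕ → Polynomial C) (r : ℕ)

variable [NeZero r]

section nuq

set_option linter.unusedSectionVars false

variable {C}

lemma nuq_zero : nuq C 0 = ⊤ := if_pos rfl

lemma nuq_of_ne_zero {a : LS C} (ha : a ≠ 0) : nuq C a = (((a.order : ℤ) : ℝ) : EReal) :=
  if_neg ha

lemma nuq_ne_bot (a : LS C) : nuq C a ≠ ⊥ := by
  by_cases ha : a = 0
  · simp [ha, nuq_zero]
  · rw [nuq_of_ne_zero ha]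
    exact EReal.coe_ne_bot _

lemma nuq_one : nuq C 1 = 0 := by
  rw [nuq_of_ne_zero one_ne_zero, HahnSeries.order_one]
  simp

lemma nuq_neg (a : LS C) : nuq C (-a) = nuq C a := by
  by_cases ha : a = 0
  · rw [ha, neg_zero]
  · rw [nuq_of_ne_zero ha, nuq_of_ne_zero (neg_ne_zero.mpr ha), HahnSeries.order_neg]

lemma nuq_mul (a b : LS C) : nuq C (a * b) = nuq C a + nuq C b := by
  by_cases ha : a = 0
  · rw [ha, zero_mul, nuq_zero, EReal.top_add_of_ne_bot (nuq_ne_bot b)]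
  by_cases hb : b = 0
  · rw [hb, mul_zero, nuq_zero, EReal.add_top_of_ne_bot (nuq_ne_bot a)]
  rw [nuq_of_ne_zero ha, nuq_of_ne_zero hb, nuq_of_ne_zero (mul_ne_zero ha hb),
    HahnSeries.order_mul ha hb]
  push_cast
  rfl

lemma min_nuq_le_nuq_add (a b : LS C) : min (nuq C a) (nuq C b) ≤ nuq C (a + b) := by
  by_cases ha : a = 0
  · simp [ha]
  by_cases hb : b = 0
  · simp [hb]
  by_cases hab : a + b = 0
  · simp [hab, nuq_zero]
  rw [nuq_of_ne_zero ha, nuq_of_ne_zero hb, nuq_of_ne_zero hab]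
  have := HahnSeries.min_order_le_order_add hab
  simpa only [min_le_iff, EReal.coe_le_coe_iff, Int.cast_le] using this

/-- The additive subgroup of Laurent series of valuation at least `v`. -/
def nuqGE (v : EReal) : AddSubgroup (LS C) where
  carrier := {a | v ≤ nuq C a}
  zero_mem' := by simp [nuq_zero]
  add_mem' {a b} ha hb := (le_min ha hb).trans (min_nuq_le_nuq_add a b)
  neg_mem' {a} ha := by
    show v ≤ nuq C (-a)
    rwa [nuq_neg]

lemma mem_nuqGE {v : EReal} {a : LS C} : a ∈ nuqGE v ↔ v ≤ nuq C a := Iff.rfl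

lemma nuq_coe_powerSeries_nonneg (p : PowerSeries (Cbar C)) :
    0 ≤ nuq C (HahnSeries.ofPowerSeries ℤ (Cbar C) p) := by
  by_cases hp : HahnSeries.ofPowerSeries ℤ (Cbar C) p = 0
  · simp [hp, nuq_zero]
  rw [nuq_of_ne_zero hp]
  have : 0 ≤ (HahnSeries.ofPowerSeries ℤ (Cbar C) p).order := by
    rw [HahnSeries.le_order_iff_forall hp]
    intro j hj
    rw [PowerSeries.coeff_coe, if_pos hj]
  exact_mod_cast this

lemma nuq_coe_powerSeries_eq_zero {p : PowerSeries (Cbar C)}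
    (hp : PowerSeries.constantCoeff p ≠ 0) :
    nuq C (HahnSeries.ofPowerSeries ℤ (Cbar C) p) = 0 := by
  have hc : (HahnSeries.ofPowerSeries ℤ (Cbar C) p).coeff 0 ≠ 0 := by
    rw [PowerSeries.coeff_coe]
    simpa using hp
  refine le_antisymm ?_ (nuq_coe_powerSeries_nonneg p)
  rw [nuq_of_ne_zero fun h => hc (by rw [h]; rfl)]
  exact_mod_cast HahnSeries.order_le_of_coeff_ne_zero hc

end nuq

section evalAt

set_option linter.unusedSectionVars false

variable {C}

lemma evalAt_toRat_s2 (α : Cbar C) (n : ℤ) (p : C[X]) :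
    evalAt C α n (toRat C p) = HahnSeries.ofPowerSeries ℤ (Cbar C)
      (((p.map (algebraMap C (Cbar C))).comp (X + Polynomial.C (α + (n : Cbar C))) :
        (Cbar C)[X]) : PowerSeries (Cbar C)) := by
  rw [evalAt, RatFunc.eval_algebraMap, Algebra.algebraMap_self, RingHom.id_apply,
    ← Polynomial.eval₂_map]
  have hX : algebraMap (Cbar C) (LS C) α + (n : LS C) + qv C =
      HahnSeries.ofPowerSeries ℤ (Cbar C)
        ((X + Polynomial.C (α + (n : Cbar C)) : (Cbar C)[X]) : PowerSeries (Cbar C)) := by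
    rw [← map_intCast (algebraMap (Cbar C) (LS C)), ← map_add, LaurentSeries.algebraMap_apply]
    simp only [Polynomial.coe_add, Polynomial.coe_X, Polynomial.coe_C, PowerSeries.coe_add,
      PowerSeries.coe_X, PowerSeries.coe_C, qv]
    exact add_comm _ _
  rw [hX]
  generalize p.map (algebraMap C (Cbar C)) = P
  generalize X + Polynomial.C (α + (n : Cbar C)) = Q
  induction P using Polynomial.induction_on' with
  | add P₁ P₂ h₁ h₂ =>
    rw [Polynomial.eval₂_add, h₁, h₂, Polynomial.add_comp, Polynomial.coe_add, map_add]
  | monomial k c =>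
    rw [Polynomial.eval₂_monomial, Polynomial.monomial_comp, Polynomial.coe_mul, map_mul,
      Polynomial.coe_C, PowerSeries.coe_C, Polynomial.coe_pow, map_pow,
      LaurentSeries.algebraMap_apply]

lemma nuq_evalAt_nonneg (α : Cbar C) (n : ℤ) (p : C[X]) :
    0 ≤ nuq C (evalAt C α n (toRat C p)) := by
  rw [evalAt_toRat_s2]
  exact nuq_coe_powerSeries_nonneg _

lemma nuq_evalAt_eq_zero {α : Cbar C} {n : ℤ} {p : C[X]}
    (hp : Polynomial.aeval (α + (n : Cbar C)) p ≠ 0) :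
    nuq C (evalAt C α n (toRat C p)) = 0 := by
  rw [evalAt_toRat_s2]
  refine nuq_coe_powerSeries_eq_zero ?_
  rw [← PowerSeries.coeff_zero_eq_constantCoeff_apply, Polynomial.coeff_coe,
    Polynomial.coeff_zero_eq_eval_zero, Polynomial.eval_comp, Polynomial.eval_map]
  simpa [Polynomial.aeval_def] using hp

lemma evalAt_ne_zero (α : Cbar C) (n : ℤ) {p : C[X]} (hp : p ≠ 0) :
    evalAt C α n (toRat C p) ≠ 0 := by
  rw [evalAt_toRat_s2, Ne, map_eq_zero_iff _ HahnSeries.ofPowerSeries_injective,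
    Polynomial.coe_eq_zero_iff, Polynomial.comp_eq_zero_iff, not_or, not_and,
    Polynomial.map_eq_zero]
  refine ⟨hp, fun _ h => ?_⟩
  have := congrArg (fun P : (Cbar C)[X] => P.coeff 1) h
  simp at this

lemma evalAt_add_intCast (α : Cbar C) (m n : ℤ) (p : RatFunc C) :
    evalAt C (α + (m : Cbar C)) n p = evalAt C α (m + n) p := by
  simp only [evalAt, map_add, map_intCast, Int.cast_add, add_assoc]

end evalAt

section window

set_option linter.unusedSectionVars false

variable {C ℓ r}

lemma mem_of_sum_mul_eq_zero {M : AddSubgroup (LS C)} {N : ℕ} {a x : ℕ → LS C}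
    (hsum : ∑ i ∈ Finset.range N, a i * x i = 0) {k : ℕ} (hk : k < N)
    (hM : ∀ i, ∀ y ∈ M, a i * y ∈ M) (hdiv : ∀ y, a k * y ∈ M → y ∈ M)
    (hx : ∀ i < N, i ≠ k → x i ∈ M) : x k ∈ M := by
  apply hdiv
  rw [← Finset.add_sum_erase _ _ (Finset.mem_range.mpr hk)] at hsum
  rw [eq_neg_of_add_eq_zero_left hsum]
  refine M.neg_mem (M.sum_mem fun i hi => hM i _ (hx i ?_ ?_))
  · exact Finset.mem_range.mp (Finset.mem_of_mem_erase hi)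
  · exact Finset.ne_of_mem_erase hi

lemma window_succ_iff {α : Cbar C} {b : ℤ → LS C} (hr : 1 ≤ r) (hb : b ∈ SolSet C ℓ r α)
    {M : AddSubgroup (LS C)} {n : ℤ}
    (hM : ∀ i, ∀ y ∈ M, evalAt C α n (toRat C (ℓ i)) * y ∈ M)
    (h₀ : ∀ y, evalAt C α n (toRat C (ℓ 0)) * y ∈ M → y ∈ M)
    (hlast : ∀ y, evalAt C α n (toRat C (ℓ r)) * y ∈ M → y ∈ M) :
    (∀ i : ℕ, i < r → b (n + 1 + i) ∈ M) ↔ ∀ i : ℕ, i < r → b (n + i) ∈ M := by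
  constructor
  · intro h
    have key : ∀ i < r + 1, i ≠ 0 → b (n + (i : ℕ)) ∈ M := by
      intro i hi hi0
      have := h (i - 1) (by omega)
      rwa [show n + 1 + ((i - 1 : ℕ) : ℤ) = n + i by omega] at this
    intro i hi
    rcases Nat.eq_zero_or_pos i with rfl | hpos
    · exact mem_of_sum_mul_eq_zero (x := fun i : ℕ => b (n + i)) (hb n) (by omega) hM h₀ key
    · exact key i (by omega) (by omega)
  · intro h i hi
    rw [show n + 1 + (i : ℤ) = n + ((i + 1 : ℕ) : ℤ) by push_cast; ring]
    rcases Nat.lt_or_ge (i + 1) r with hlt | hge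
    · exact h _ hlt
    · obtain rfl : r = i + 1 := by omega
      exact mem_of_sum_mul_eq_zero (x := fun i : ℕ => b (n + i)) (hb n) (by omega) hM hlast
        fun j hj hne => h j (by omega)

/-- A solution that vanishes on one full window of initial values is zero. -/
lemma eq_zero_of_window_eq_zero {α : Cbar C} {b : ℤ → LS C} (hr : 1 ≤ r)
    (hℓ : ℓ 0 * ℓ r ≠ 0) (hb : b ∈ SolSet C ℓ r α) {z₀ : ℤ}
    (h : ∀ i : ℕ, i < r → b (z₀ + i) = 0) : b = 0 := by
  have step (n : ℤ) : (∀ i : ℕ, i < r → b (n + 1 + i) = 0) ↔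
      ∀ i : ℕ, i < r → b (n + i) = 0 := by
    have := window_succ_iff (M := (⊥ : AddSubgroup (LS C))) (n := n) hr hb
      (by simp +contextual)
      (by simp [evalAt_ne_zero α n (left_ne_zero_of_mul hℓ)])
      (by simp [evalAt_ne_zero α n (right_ne_zero_of_mul hℓ)])
    simpa only [AddSubgroup.mem_bot] using this
  have all (n : ℤ) : ∀ i : ℕ, i < r → b (n + i) = 0 := by
    induction n using Int.inductionOn' (b := z₀) with
    | zero => exact h
    | succ k _ ih => exact (step k).mpr ih
    | pred k _ ih =>
      refine (step (k - 1)).mp ?_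
      rwa [sub_add_cancel]
  funext n
  simpa using all n 0 (by omega)

/-- To the left of all roots of `ℓ₀ ℓ_r`, lower bounds on the valuation propagate between
windows of `r` consecutive values of a solution. -/
lemma le_nuq_window_iff {α : Cbar C} {b : ℤ → LS C} (hr : 1 ≤ r)
    (hb : b ∈ SolSet C ℓ r α) {z₀ : ℤ}
    (hroots : ∀ m : ℤ, m < z₀ → (Polynomial.aeval (α + (m : Cbar C))) (ℓ 0 * ℓ r) ≠ 0)
    (v : EReal) {n : ℤ} (hn : n ≤ z₀) :
    (∀ i : ℕ, i < r → v ≤ nuq C (b (n + i))) ↔ ∀ i : ℕ, i < r → v ≤ nuq C (b (z₀ + i)) := by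
  have step (k : ℤ) (hk : k < z₀) : (∀ i : ℕ, i < r → v ≤ nuq C (b (k + 1 + i))) ↔
      ∀ i : ℕ, i < r → v ≤ nuq C (b (k + i)) := by
    have hroot := hroots k hk
    rw [map_mul] at hroot
    refine window_succ_iff (M := nuqGE v) (n := k) hr hb (fun i y hy => ?_) (fun y hy => ?_)
      fun y hy => ?_
    · rw [mem_nuqGE] at hy ⊢
      rw [nuq_mul]
      simpa using add_le_add (nuq_evalAt_nonneg α k (ℓ i)) hy
    · rwa [mem_nuqGE, nuq_mul, nuq_evalAt_eq_zero (left_ne_zero_of_mul hroot), zero_add] at hy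
    · rwa [mem_nuqGE, nuq_mul, nuq_evalAt_eq_zero (right_ne_zero_of_mul hroot), zero_add] at hy
  induction n, hn using Int.leInductionDown with
  | base => rfl
  | pred k hk ih =>
    refine (step (k - 1) (by omega)).symm.trans ?_
    rwa [sub_add_cancel]

lemma liminf_nuq_le {α : Cbar C} {b : ℤ → LS C} (hr : 1 ≤ r)
    (hb : b ∈ SolSet C ℓ r α) {z₀ : ℤ}
    (hroots : ∀ m : ℤ, m < z₀ → (Polynomial.aeval (α + (m : Cbar C))) (ℓ 0 * ℓ r) ≠ 0)
    (m : ℤ) {i : ℕ} (hi : i < r) :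
    liminf (fun n : ℕ => nuq C (b (m - n))) atTop ≤ nuq C (b (z₀ + i)) := by
  refine le_of_forall_lt fun v hv => ?_
  obtain ⟨v', hvv', hv'⟩ := exists_between hv
  refine hvv'.trans_le ?_
  obtain ⟨N, hN⟩ := eventually_atTop.mp (eventually_lt_of_lt_liminf hv')
  let K : ℕ := N + r + (m - z₀).toNat
  refine (le_nuq_window_iff hr hb hroots v' (n := m - K) (by omega)).mp (fun j hj => ?_) i hi
  have := hN (K - j) (by omega)
  rw [show m - ((K - j : ℕ) : ℤ) = m - K + j by omega] at this
  exact this.le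

lemma le_liminf_nuq {α : Cbar C} {b : ℤ → LS C} (hr : 1 ≤ r)
    (hb : b ∈ SolSet C ℓ r α) {z₀ : ℤ}
    (hroots : ∀ m : ℤ, m < z₀ → (Polynomial.aeval (α + (m : Cbar C))) (ℓ 0 * ℓ r) ≠ 0)
    (m : ℤ) {v : EReal} (hv : ∀ i : ℕ, i < r → v ≤ nuq C (b (z₀ + i))) :
    v ≤ liminf (fun n : ℕ => nuq C (b (m - n))) atTop := by
  refine le_liminf_of_le (by isBoundedDefault) ?_
  filter_upwards [eventually_ge_atTop (m - z₀).toNat] with n hn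
  have := (le_nuq_window_iff hr hb hroots v (n := m - n) (by omega)).mpr hv 0 (by omega)
  simpa using this

/-- Expansion of a solution in the basis determined by its initial values at `z₀`. -/
lemma eq_sum_basis {α : Cbar C} (hr : 1 ≤ r) (hℓ : ℓ 0 * ℓ r ≠ 0) {z₀ : ℤ}
    {b : Fin r → (ℤ → LS C)} (hbsol : ∀ j, b j ∈ SolSet C ℓ r α)
    (hbinit : ∀ i j : Fin r, b j (z₀ + (i : ℤ)) = if i = j then 1 else 0)
    {s : ℤ → LS C} (hs : s ∈ SolSet C ℓ r α) (n : ℤ) :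
    s n = ∑ j : Fin r, s (z₀ + (j : ℤ)) * b j n := by
  have hdiff : (fun n => s n - ∑ j : Fin r, s (z₀ + (j : ℤ)) * b j n) ∈ SolSet C ℓ r α := by
    intro k
    simp only [mul_sub, Finset.sum_sub_distrib, Finset.mul_sum]
    rw [hs k, Finset.sum_comm, zero_sub, neg_eq_zero]
    refine Finset.sum_eq_zero fun j _ => ?_
    simp only [mul_left_comm _ (s (z₀ + (j : ℤ)))]
    rw [← Finset.mul_sum, hbsol j k, mul_zero]
  have h0 := eq_zero_of_window_eq_zero (z₀ := z₀) hr hℓ hdiff fun i hi => by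
    have := hbinit ⟨i, hi⟩
    simp only at this
    simp [this]
  exact sub_eq_zero.mp (congrFun h0 n)

end window

theorem statement2 (hr : 1 ≤ r) (hℓ : ℓ 0 * ℓ r ≠ 0) (α : Cbar C) (z₀ : ℤ)
    (hroots : ∀ m : ℤ, m < z₀ → (Polynomial.aeval (α + (m : Cbar C))) (ℓ 0 * ℓ r) ≠ 0)
    (b : Fin r → (ℤ → LS C)) (hbsol : ∀ j, b j ∈ SolSet C ℓ r α)
    (hbinit : ∀ i j : Fin r, b j (z₀ + (i : ℤ)) = if i = j then 1 else 0)
    (f : Fin r → RatFunc C) (m : ℤ) :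
    valAt C ℓ r (α + (m : Cbar C)) f
      = ⨅ j : Fin r, nuq C (elemApply C r α f (b j) m) := by
  have eval_shift (s : ℤ → LS C) :
      elemApply C r (α + (m : Cbar C)) f s 0 = elemApply C r α f (fun n => s (n - m)) m := by
    simp only [elemApply, evalAt_add_intCast, add_zero]
    refine Finset.sum_congr rfl fun i _ => ?_
    congr 2
    ring
  have hlim (s : ℤ → LS C) : liminf (fun n : ℕ => nuq C (s (-(n : ℤ)))) atTop =
      liminf (fun n : ℕ => nuq C ((fun k => s (k - m)) (m - (n : ℤ)))) atTop := by
    simp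
  apply le_antisymm
  · refine le_iInf fun j => ?_
    have hsol : (fun n => b j (n + m)) ∈ SolSet C ℓ r (α + (m : Cbar C)) := by
      intro n
      rw [← hbsol j (m + n)]
      refine Finset.sum_congr rfl fun i _ => ?_
      rw [evalAt_add_intCast, show m + n + (i : ℤ) = n + i + m by ring]
    refine (iInf₂_le _ hsol).trans ?_
    have hL : liminf (fun n : ℕ => nuq C (b j (m - n))) atTop = 0 := by
      apply le_antisymm
      · have := liminf_nuq_le hr (hbsol j) hroots m j.isLt
        rwa [hbinit j j, if_pos rfl, nuq_one] at this
      · refine le_liminf_nuq hr (hbsol j) hroots m fun i hi => ?_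
        rw [hbinit ⟨i, hi⟩ j]
        split_ifs
        · rw [nuq_one]
        · simp [nuq_zero]
    rw [eval_shift, hlim fun n => b j (n + m)]
    simp only [sub_add_cancel]
    rw [hL, esub, if_neg EReal.zero_ne_top, sub_zero]
  · refine le_iInf₂ fun s' hs' => ?_
    rw [eval_shift, hlim s']
    generalize hs : (fun n => s' (n - m)) = s
    have hsol : s ∈ SolSet C ℓ r α := by
      intro n
      rw [← hs' (n - m)]
      refine Finset.sum_congr rfl fun i _ => ?_
      rw [evalAt_add_intCast, ← hs, show m + (n - m) = n by ring,
        show n - m + (i : ℤ) = n + i - m by ring]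
    rw [esub]
    split_ifs with htop
    · exact le_top
    have hexp : elemApply C r α f s m =
        ∑ j : Fin r, s (z₀ + (j : ℤ)) * elemApply C r α f (b j) m := by
      simp only [elemApply, Finset.mul_sum]
      rw [Finset.sum_comm]
      refine Finset.sum_congr rfl fun i _ => ?_
      rw [eq_sum_basis hr hℓ hbsol hbinit hsol (m + (i : ℤ)), Finset.mul_sum]
      exact Finset.sum_congr rfl fun j _ => mul_left_comm _ _ _
    rw [EReal.le_sub_iff_add_le (Or.inr (nuq_ne_bot _)) (Or.inl htop), hexp, ← mem_nuqGE]
    refine AddSubgroup.sum_mem _ fun j _ => ?_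
    rw [mem_nuqGE, nuq_mul, add_comm]
    exact add_le_add (liminf_nuq_le hr hsol hroots m j.isLt) (iInf_le _ j)

end PRec
end
end

section
/- For every α ∈ C̄ and every f ∈ A: f is locally integral at α if and only if Sf is locally integral at α − 1. -/
set_option maxHeartbeats 1000000
set_option synthInstance.maxHeartbeats 200000

open Polynomial Filter

noncomputable section

namespace PRec

variable (C : Type*) [Field C] [CharZero C]

variable (ℓ : ℕ → Polynomial C) (r : ℕ)

variable [NeZero r]

omit [CharZero C] in
/-- No nonzero polynomial over `C̄` vanishes at the Laurent-series variable. -/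
theorem aeval_qv_injective :
    Function.Injective (Polynomial.aeval (qv C) : Polynomial (Cbar C) →ₐ[Cbar C] LS C) := by
  have h : (Polynomial.aeval (qv C) : Polynomial (Cbar C) →ₐ[Cbar C] LS C).toRingHom =
      (HahnSeries.ofPowerSeries ℤ (Cbar C)).comp Polynomial.coeToPowerSeries.ringHom := by
    refine Polynomial.ringHom_ext (fun a => ?_) ?_
    · simp [LaurentSeries.algebraMap_apply]
    · simp [qv]
  have hinj : Function.Injective
      ((HahnSeries.ofPowerSeries ℤ (Cbar C)).comp Polynomial.coeToPowerSeries.ringHom) :=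
    HahnSeries.ofPowerSeries_injective.comp (Polynomial.coe_injective _)
  rw [← h] at hinj
  exact hinj

omit [CharZero C] in
/-- No nonzero polynomial over `C` vanishes at `α + m + q`. -/
theorem eval₂_add_qv_ne_zero (α : Cbar C) (m : ℤ) {p : Polynomial C} (hp : p ≠ 0) :
    p.eval₂ ((algebraMap (Cbar C) (LS C)).comp (algebraMap C (Cbar C)))
      (algebraMap (Cbar C) (LS C) α + (m : LS C) + qv C) ≠ 0 := by
  have h : p.eval₂ ((algebraMap (Cbar C) (LS C)).comp (algebraMap C (Cbar C)))
      (algebraMap (Cbar C) (LS C) α + (m : LS C) + qv C) =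
      Polynomial.aeval (qv C)
        ((p.map (algebraMap C (Cbar C))).comp (X + Polynomial.C (α + (m : Cbar C)))) := by
    rw [Polynomial.aeval_comp, Polynomial.aeval_def, Polynomial.eval₂_map]
    congr 1
    simp [add_comm, add_left_comm]
  rw [h, map_ne_zero_iff _ (aeval_qv_injective C), ← Polynomial.taylor_apply]
  simpa using hp

/-- Evaluation at `α + m + q` as a ring homomorphism `C(x) → C̄((q))`. -/
def evalHom (α : Cbar C) (m : ℤ) : RatFunc C →+* LS C where
  toFun := evalAt C α m
  map_one' := RatFunc.eval_one ..
  map_zero' := RatFunc.eval_zero ..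
  map_add' p p' := RatFunc.eval_add _ _
    (eval₂_add_qv_ne_zero C α m p.denom_ne_zero) (eval₂_add_qv_ne_zero C α m p'.denom_ne_zero)
  map_mul' p p' := RatFunc.eval_mul _ _
    (eval₂_add_qv_ne_zero C α m p.denom_ne_zero) (eval₂_add_qv_ne_zero C α m p'.denom_ne_zero)

omit [CharZero C] in
theorem evalHom_apply (α : Cbar C) (m : ℤ) (p : RatFunc C) :
    evalHom C α m p = evalAt C α m p := rfl

omit [CharZero C] in
theorem evalAt_sub_one (α : Cbar C) (m : ℤ) (p : RatFunc C) :
    evalAt C (α - 1) (m + 1) p = evalAt C α m p := by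
  unfold evalAt
  congr 1
  push_cast [map_sub, map_one]
  ring

omit [CharZero C] in
theorem evalAt_ratσ (α : Cbar C) (m : ℤ) (p : RatFunc C) :
    evalAt C α m (ratσ C p) = evalAt C α (m + 1) p := by
  suffices h : (evalHom C α m).comp (ratσ C) = evalHom C α (m + 1) from RingHom.congr_fun h p
  refine IsFractionRing.ringHom_ext (A := Polynomial C) fun p => ?_
  have hσ : ratσ C (algebraMap (Polynomial C) (RatFunc C) p) =
      algebraMap (Polynomial C) (RatFunc C) (p.comp (X + Polynomial.C 1)) := by
    have h := RatFunc.map_apply_div (polyσ C : Polynomial C →+* Polynomial C)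
      (by
        intro p hp
        exact mem_nonZeroDivisors_iff_ne_zero.mpr
          ((map_ne_zero_iff _ (polyσ C).injective).mpr (mem_nonZeroDivisors_iff_ne_zero.mp hp)))
      p 1
    simp only [map_one, div_one] at h
    exact h
  rw [RingHom.comp_apply, hσ, evalHom_apply, evalHom_apply, evalAt, evalAt,
    RatFunc.eval_algebraMap, RatFunc.eval_algebraMap]
  simp [Polynomial.eval₂_comp, add_right_comm _ (qv C), add_assoc]

omit [CharZero C] in
/-- On solutions of `L`, the action of `S f` is the shifted action of `f`. -/
theorem elemApply_Smap (hℓ : ℓ r ≠ 0) (α : Cbar C) (f : Fin r → RatFunc C)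
    {b : ℤ → LS C} (hb : b ∈ SolSet C ℓ r α) (n : ℤ) :
    elemApply C r α (Smap C ℓ r f) b n = elemApply C r α f b (n + 1) := by
  obtain ⟨k, rfl⟩ := Nat.exists_eq_succ_of_ne_zero (NeZero.ne r)
  have hr : evalHom C α n (toRat C (ℓ (k + 1))) ≠ 0 := by
    rw [_root_.map_ne_zero]
    exact RatFunc.algebraMap_ne_zero hℓ
  have hsol := hb n
  rw [Finset.sum_range_succ, Finset.sum_range] at hsol
  simp only [← evalHom_apply] at hsol
  have hlast : ∑ j : Fin (k + 1), evalHom C α n (toRat C (ℓ j) / toRat C (ℓ (k + 1))) * b (n + j)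
      = -b (n + (k + 1 : ℕ)) := by
    simp only [map_div₀, div_mul_eq_mul_div, ← Finset.sum_div]
    rw [div_eq_iff hr]
    linear_combination hsol
  have hS : ∀ j : Fin (k + 1), evalAt C α n (Smap C ℓ (k + 1) f j) * b (n + j) =
      evalHom C α n (if (j : ℕ) = 0 then 0 else
        ratσ C (f ⟨(j : ℕ) - 1, lt_of_le_of_lt (Nat.sub_le _ _) j.isLt⟩)) * b (n + j) -
      evalHom C α n (ratσ C (f (Fin.last k))) *
        (evalHom C α n (toRat C (ℓ j) / toRat C (ℓ (k + 1))) * b (n + j)) := by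
    intro j
    rw [← evalHom_apply, Smap, map_sub, map_mul, sub_mul, mul_assoc]
    rfl
  unfold elemApply
  rw [Finset.sum_congr rfl fun j _ => hS j, Finset.sum_sub_distrib, ← Finset.mul_sum, hlast,
    Fin.sum_univ_succ, Fin.sum_univ_castSucc]
  have h0 : evalAt C α n 0 = 0 := RatFunc.eval_zero ..
  simp [evalHom_apply, evalAt_ratσ, h0, add_assoc, add_comm (1 : ℤ), Fin.castSucc, Fin.castAdd,
    Fin.castLE]

omit [CharZero C] [NeZero r] in
/-- Reindexing identifies `Sol_α(L)` with `Sol_{α-1}(L)`. -/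
theorem mem_SolSet_sub_one (α : Cbar C) (b : ℤ → LS C) :
    (fun n => b (n - 1)) ∈ SolSet C ℓ r (α - 1) ↔ b ∈ SolSet C ℓ r α := by
  refine ((Equiv.addRight (1 : ℤ)).forall_congr fun n => ?_).symm
  simp [evalAt_sub_one, add_right_comm]

omit [CharZero C] in
theorem valAt_Smap (hℓ : ℓ r ≠ 0) (α : Cbar C) (f : Fin r → RatFunc C) :
    valAt C ℓ r (α - 1) (Smap C ℓ r f) = valAt C ℓ r α f := by
  unfold valAt
  refine (Equiv.iInf_congr ((Equiv.subRight (1 : ℤ)).symm.arrowCongr (Equiv.refl (LS C)))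
    fun b => iInf_congr_Prop (mem_SolSet_sub_one C ℓ r α b) fun hb => ?_).symm
  have hb' := (mem_SolSet_sub_one C ℓ r α b).2 hb
  congr 1
  · refine congrArg _ ((elemApply_Smap C ℓ r hℓ (α - 1) f hb' 0).trans ?_)
    simp only [elemApply, evalAt_sub_one]
    simp
  · refine Eq.trans ?_ (liminf_nat_add (fun n : ℕ => nuq C (b (-(n : ℤ)))) 1)
    congr 1
    ext n
    simp [sub_eq_add_neg, add_comm]

theorem statement5 [NeZero r] (hr : 1 ≤ r) (hℓ : ℓ 0 * ℓ r ≠ 0) (α : Cbar C)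
    (f : Fin r → RatFunc C) :
    IntegralAt C ℓ r α f ↔ IntegralAt C ℓ r (α - 1) (Smap C ℓ r f) := by
  unfold IntegralAt
  rw [valAt_Smap C ℓ r (right_ne_zero_of_mul hℓ)]

end PRec
end
end
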